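/- arXiv:1401.6788 — 2 statements merged into one kernel-verified Lean document; each statement's English description precedes it below -/
import Mathlib

section
/- Fix an odd integer r ≥ 3 and take n = 2, so A(2,r) is the 3×3 integer matrix defined in the context. Then coker A(2,r) is isomorphic as an abelian group to ℤ × ℤ/rℤ × ℤ/rℤ; moreover, in coker A(2,r) the elements e_1 and e_2 each have additive order r. -/
/-- The (n+1)×(n+1) integer matrix A(n,r) with entries
    A_{ij} = (-1)^(i-j+1) * binom(r, i-j) for i > j and 0 otherwise. -/
def lensMatrix (n r : ℕ) : Matrix (Fin (n+1)) (Fin (n+1)) ℤ :=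
  fun i j => if (j : ℕ) < (i : ℕ)
    then (-1 : ℤ) ^ ((i : ℕ) - (j : ℕ) + 1) * (r.choose ((i : ℕ) - (j : ℕ)) : ℤ)
    else 0

/-- The cokernel ℤ^(n+1) / Im A(n,r). -/
abbrev lensCoker (n r : ℕ) : Type :=
  (Fin (n+1) → ℤ) ⧸ LinearMap.range (Matrix.toLin' (lensMatrix n r))

/-- The image e_j in the cokernel of the j-th standard basis vector of ℤ^(n+1). -/
def lensE (n r : ℕ) (j : Fin (n+1)) : lensCoker n r :=
  Submodule.Quotient.mk (Pi.single j 1)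

/-- The coordinatewise reduction `ℤ³ → ℤ × ℤ/r × ℤ/r`. -/
def reduceLastTwo (r : ℕ) : (Fin (2 + 1) → ℤ) →ₗ[ℤ] ℤ × ZMod r × ZMod r :=
  (LinearMap.proj 0).prod
    (((Int.castAddHom (ZMod r)).toIntLinearMap ∘ₗ LinearMap.proj 1).prod
      ((Int.castAddHom (ZMod r)).toIntLinearMap ∘ₗ LinearMap.proj 2))

theorem reduceLastTwo_apply (r : ℕ) (x : Fin (2 + 1) → ℤ) :
    reduceLastTwo r x = (x 0, (x 1 : ZMod r), (x 2 : ZMod r)) := rfl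

theorem reduceLastTwo_surjective (r : ℕ) : Function.Surjective (reduceLastTwo r) := by
  rintro ⟨a, b, c⟩
  obtain ⟨b, rfl⟩ := ZMod.intCast_surjective b
  obtain ⟨c, rfl⟩ := ZMod.intCast_surjective c
  exact ⟨![a, b, c], rfl⟩

theorem lensMatrix_two_mulVec (r : ℕ) (y : Fin (2 + 1) → ℤ) :
    (lensMatrix 2 r).mulVec y = ![0, r * y 0, r * y 1 - r.choose 2 * y 0] := by
  ext i
  fin_cases i <;> simp [Matrix.mulVec, dotProduct, Fin.sum_univ_three, lensMatrix]
  ring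

theorem Odd.dvd_choose_two {r : ℕ} (h : Odd r) : r ∣ r.choose 2 := by
  obtain ⟨m, rfl⟩ := h
  refine ⟨m, ?_⟩
  rw [Nat.choose_two_right, Nat.add_sub_cancel, mul_left_comm, Nat.mul_div_cancel_left _ two_pos]

theorem range_lensMatrix_two {r : ℕ} (h : Odd r) :
    LinearMap.range (Matrix.toLin' (lensMatrix 2 r)) = LinearMap.ker (reduceLastTwo r) := by
  obtain ⟨m, hm⟩ := h.dvd_choose_two
  ext x
  simp only [LinearMap.mem_range, LinearMap.mem_ker, Matrix.toLin'_apply, lensMatrix_two_mulVec,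
    reduceLastTwo_apply, Prod.mk_eq_zero, ZMod.intCast_zmod_eq_zero_iff_dvd,
    hm]
  constructor
  · rintro ⟨y, rfl⟩
    refine ⟨rfl, ⟨y 0, rfl⟩, ⟨y 1 - m * y 0, ?_⟩⟩
    simp
    ring
  · rintro ⟨h0, ⟨a, ha⟩, ⟨b, hb⟩⟩
    refine ⟨![a, b + m * a, 0], ?_⟩
    ext i
    fin_cases i <;> simp [h0, ha, hb]
    ring

/-- For odd `r`, the cokernel of `A(2,r)` is `ℤ × ℤ/r × ℤ/r`. -/
noncomputable def lensCokerTwoEquiv {r : ℕ} (h : Odd r) :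
    lensCoker 2 r ≃ₗ[ℤ] ℤ × ZMod r × ZMod r :=
  (Submodule.quotEquivOfEq _ _ (range_lensMatrix_two h)).trans
    ((reduceLastTwo r).quotKerEquivOfSurjective (reduceLastTwo_surjective r))

theorem lensCokerTwoEquiv_lensE {r : ℕ} (h : Odd r) (j : Fin (2 + 1)) :
    lensCokerTwoEquiv h (lensE 2 r j) = reduceLastTwo r (Pi.single j 1) := rfl

theorem addOrderOf_lensE_two {r : ℕ} (h : Odd r) (j : Fin (2 + 1)) :
    addOrderOf (lensE 2 r j) = addOrderOf (reduceLastTwo r (Pi.single j 1)) := by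
  rw [← lensCokerTwoEquiv_lensE h]
  exact (addOrderOf_injective (lensCokerTwoEquiv h).toAddEquiv.toAddMonoidHom
    (lensCokerTwoEquiv h).injective _).symm

/-- For n = 2 and odd r ≥ 3, coker A(2,r) ≅ ℤ × ℤ/r × ℤ/r;
    e₁ and e₂ each have order r. -/
theorem lens_coker_n_two_odd (r : ℕ) (hr : 3 ≤ r) (hodd : Odd r) :
    Nonempty (lensCoker 2 r ≃+ ℤ × ZMod r × ZMod r) ∧
    addOrderOf (lensE 2 r 1) = r ∧
    addOrderOf (lensE 2 r 2) = r := by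
  refine ⟨⟨(lensCokerTwoEquiv hodd).toAddEquiv⟩, ?_, ?_⟩ <;>
    rw [addOrderOf_lensE_two hodd, reduceLastTwo_apply] <;>
    simp [Prod.addOrderOf, ZMod.addOrderOf_one]
end

section
/- Fix an integer r ≥ 2 coprime to 6 (i.e. r ≡ 1 or 5 mod 6), and take n = 3, so A(3,r) is the 4×4 integer matrix defined in the context. Then coker A(3,r) is isomorphic as an abelian group to ℤ × ℤ/rℤ × ℤ/rℤ × ℤ/rℤ; moreover, in coker A(3,r) the elements e_1, e_2 and e_3 each have additive order r. -/
theorem Nat.Coprime.dvd_choose_self {r k : ℕ} (hk : k ≠ 0) (h : r.Coprime k) :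
    r ∣ r.choose k := by
  obtain ⟨k, rfl⟩ := Nat.exists_eq_succ_of_ne_zero hk
  cases r with
  | zero => simp
  | succ r =>
    refine h.dvd_of_dvd_mul_right ?_
    exact ⟨r.choose k, (Nat.add_one_mul_choose_eq r k).symm⟩

/-- The homomorphism `ℤ⁴ → ℤ × (ℤ/r)³` reducing the last three coordinates modulo `r`. -/
def reduceTail (r : ℕ) : (Fin 4 → ℤ) →ₗ[ℤ] ℤ × ZMod r × ZMod r × ZMod r :=
  AddMonoidHom.toIntLinearMap
    { toFun := fun v => (v 0, (v 1 : ZMod r), (v 2 : ZMod r), (v 3 : ZMod r))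
      map_zero' := by simp
      map_add' := by simp }

theorem reduceTail_apply (r : ℕ) (v : Fin 4 → ℤ) :
    reduceTail r v = (v 0, (v 1 : ZMod r), (v 2 : ZMod r), (v 3 : ZMod r)) := rfl

theorem mem_ker_reduceTail {r : ℕ} {v : Fin 4 → ℤ} :
    v ∈ LinearMap.ker (reduceTail r) ↔
      v 0 = 0 ∧ (r : ℤ) ∣ v 1 ∧ (r : ℤ) ∣ v 2 ∧ (r : ℤ) ∣ v 3 := by
  simp [reduceTail_apply, CharP.intCast_eq_zero_iff _ r]

theorem reduceTail_surjective (r : ℕ) : Function.Surjective (reduceTail r) := by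
  rintro ⟨a, b, c, d⟩
  obtain ⟨b, rfl⟩ := ZMod.intCast_surjective b
  obtain ⟨c, rfl⟩ := ZMod.intCast_surjective c
  obtain ⟨d, rfl⟩ := ZMod.intCast_surjective d
  exact ⟨![a, b, c, d], rfl⟩

theorem lensMatrix_three_mulVec (r : ℕ) (v : Fin 4 → ℤ) :
    (lensMatrix 3 r).mulVec v =
      ![0, r * v 0, -r.choose 2 * v 0 + r * v 1,
        r.choose 3 * v 0 - r.choose 2 * v 1 + r * v 2] := by
  ext i
  fin_cases i <;> simp [lensMatrix, Matrix.mulVec, dotProduct, Fin.sum_univ_four]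
  ring

theorem range_lensMatrix_three {r : ℕ} (hcop : r.Coprime 6) :
    LinearMap.range (Matrix.toLin' (lensMatrix 3 r)) = LinearMap.ker (reduceTail r) := by
  have h2 : (r : ℤ) ∣ r.choose 2 := Int.natCast_dvd_natCast.2 <|
    (hcop.coprime_dvd_right (by norm_num)).dvd_choose_self two_ne_zero
  have h3 : (r : ℤ) ∣ r.choose 3 := Int.natCast_dvd_natCast.2 <|
    (hcop.coprime_dvd_right (by norm_num)).dvd_choose_self three_ne_zero
  obtain ⟨s, hs⟩ := h2
  obtain ⟨t, ht⟩ := h3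
  ext v
  rw [mem_ker_reduceTail]
  simp only [LinearMap.mem_range, Matrix.toLin'_apply, lensMatrix_three_mulVec, hs, ht]
  constructor
  · rintro ⟨w, rfl⟩
    refine ⟨rfl, ⟨w 0, rfl⟩, ⟨-s * w 0 + w 1, ?_⟩, ⟨t * w 0 - s * w 1 + w 2, ?_⟩⟩
    · simp; ring
    · simp; ring
  · rintro ⟨h0, ⟨a, ha⟩, ⟨b, hb⟩, ⟨c, hc⟩⟩
    refine ⟨![a, b + s * a, c - t * a + s * (b + s * a), 0], ?_⟩
    ext i
    fin_cases i <;> simp [h0, ha, hb, hc] <;> ring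

/-- The isomorphism `coker A(3,r) ≃ ℤ × (ℤ/r)³` induced by `reduceTail`. -/
noncomputable def lensCokerThreeEquiv {r : ℕ} (hcop : r.Coprime 6) :
    lensCoker 3 r ≃ₗ[ℤ] ℤ × ZMod r × ZMod r × ZMod r :=
  (Submodule.quotEquivOfEq _ _ (range_lensMatrix_three hcop)).trans
    ((reduceTail r).quotKerEquivOfSurjective (reduceTail_surjective r))

theorem lensCokerThreeEquiv_lensE {r : ℕ} (hcop : r.Coprime 6) (j : Fin 4) :
    lensCokerThreeEquiv hcop (lensE 3 r j) = reduceTail r (Pi.single j 1) := rfl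

theorem addOrderOf_lensE_three {r : ℕ} (hcop : r.Coprime 6) (j : Fin 4) :
    addOrderOf (lensE 3 r j) = addOrderOf (reduceTail r (Pi.single j 1)) := by
  rw [← lensCokerThreeEquiv_lensE hcop]
  exact (addOrderOf_injective (lensCokerThreeEquiv hcop).toAddEquiv.toAddMonoidHom
    (lensCokerThreeEquiv hcop).injective _).symm

/-- For n = 3 and r ≥ 2 coprime to 6,
    coker A(3,r) ≅ ℤ × ℤ/r × ℤ/r × ℤ/r, with e₁, e₂, e₃ each of order r. -/
theorem lens_coker_n_three_coprime_six (r : ℕ) (hr : 2 ≤ r)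
    (hcop : Nat.Coprime r 6) :
    Nonempty (lensCoker 3 r ≃+ ℤ × ZMod r × ZMod r × ZMod r) ∧
    addOrderOf (lensE 3 r 1) = r ∧
    addOrderOf (lensE 3 r 2) = r ∧
    addOrderOf (lensE 3 r 3) = r := by
  refine ⟨⟨(lensCokerThreeEquiv hcop).toAddEquiv⟩, ?_, ?_, ?_⟩ <;>
    rw [addOrderOf_lensE_three hcop] <;>
    simp [reduceTail_apply, Prod.addOrderOf, ZMod.addOrderOf_one]
end
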